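/- Let A be a commutative ℝ-algebra and let D_1,…,D_n (n ≥ 2) be ℝ-linear derivations of A that pairwise commute (D_i ∘ D_j = D_j ∘ D_i for all i, j). Then the bracket {f_1,…,f_n} := det (D_i f_j)_{1 ≤ i,j ≤ n} (the determinant of the n×n matrix with (i,j) entry D_i f_j) is alternating and ℝ-multilinear, satisfies the Leibniz rule in each argument, and satisfies the Fundamental identity; i.e., it is a Nambu-Poisson bracket of order n on A. (Applied to A = C^∞(M;ℝ) and commuting vector fields X_1,…,X_n this says that Π = X_1 ∧ ⋯ ∧ X_n defines a Nambu structure of order n.) -/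

import Mathlib

/-- The Fundamental identity for an `(p+1)`-ary bracket. -/
def FundamentalIdentity {V : Type*} [AddCommMonoid V] {p : ℕ}
    (B : (Fin (p + 1) → V) → V) : Prop :=
  ∀ (f : Fin p → V) (g : Fin (p + 1) → V),
    B (Fin.snoc f (B g)) = ∑ k, B (Function.update g k (B (Fin.snoc f (g k))))

/-- The Leibniz rule in each argument for an `n`-ary bracket on a commutative ring. -/
def LeibnizRule {A : Type*} [CommRing A] {n : ℕ} (B : (Fin n → A) → A) : Prop :=
  ∀ (v : Fin n → A) (i : Fin n) (f g : A),
    B (Function.update v i (f * g)) =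
      f * B (Function.update v i g) + B (Function.update v i f) * g

namespace NambuAux

open Matrix

variable {A : Type*} [CommRing A] [Algebra ℝ A] {n : ℕ}

theorem der_prod {ι : Type*} [DecidableEq ι] (X : Derivation ℝ A A) (s : Finset ι) (f : ι → A) :
    X (∏ i ∈ s, f i) = ∑ k ∈ s, ∏ i ∈ s, Function.update f k (X (f k)) i := by
  induction s using Finset.induction_on with
  | empty => simp
  | insert a s ha ih =>
    rw [Finset.prod_insert ha, Derivation.leibniz, ih, Finset.sum_insert ha, Finset.prod_insert ha,
      add_comm]
    congr 1
    · rw [Function.update_self, smul_eq_mul, mul_comm]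
      congr 1
      refine Finset.prod_congr rfl fun i hi => ?_
      rw [Function.update_of_ne]
      rintro rfl
      exact ha hi
    · rw [smul_eq_mul, Finset.mul_sum]
      refine Finset.sum_congr rfl fun k hk => ?_
      rw [Finset.prod_insert ha, Function.update_of_ne]
      rintro rfl
      exact ha hk

theorem der_det (X : Derivation ℝ A A) (M : Matrix (Fin n) (Fin n) A) :
    X M.det = ∑ k, (M.updateRow k (fun i => X (M k i))).det := by
  have h : ∀ N : Matrix (Fin n) (Fin n) A, N.det =
      ∑ σ : Equiv.Perm (Fin n), (Equiv.Perm.sign σ : ℤ) • ∏ i, N i (σ i) := by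
    intro N
    rw [← det_transpose, det_apply]
    rfl
  rw [h, map_sum]
  simp_rw [h]
  rw [Finset.sum_comm]
  refine Finset.sum_congr rfl fun σ _ => ?_
  rw [map_zsmul, der_prod, Finset.smul_sum]
  refine Finset.sum_congr rfl fun k _ => ?_
  congr 1
  refine Finset.prod_congr rfl fun i _ => ?_
  by_cases hik : i = k
  · subst hik; simp
  · simp [hik, updateRow_ne]

theorem det_upd (M : Matrix (Fin n) (Fin n) A) (k : Fin n) (b : Fin n → A) :
    (M.updateRow k b).det = ∑ i, b i * M.adjugate i k := by
  rw [← cramer_transpose_apply, cramer_eq_adjugate_mulVec, ← adjugate_transpose]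
  simp [mulVec, dotProduct, mul_comm]

theorem trace_upd (G N : Matrix (Fin n) (Fin n) A) :
    ∑ k, (G.updateRow k ((G * N) k)).det = N.trace * G.det := by
  have : ∑ k, (G.updateRow k ((G * N) k)).det = ((G * N) * G.adjugate).trace := by
    simp only [det_upd, trace, diag, mul_apply (M := G * N)]
  rw [this, trace_mul_comm, ← Matrix.mul_assoc, adjugate_mul]
  simp [mul_comm]

/-- the Jacobian, with rows indexed by functions -/
def J (D : Fin n → Derivation ℝ A A) (f : Fin n → A) : Matrix (Fin n) (Fin n) A :=
  fun j i => D i (f j)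

theorem J_update (D : Fin n → Derivation ℝ A A) (f : Fin n → A) (k : Fin n) (a : A) :
    J D (Function.update f k a) = (J D f).updateRow k (fun i => D i a) := by
  ext j i
  by_cases h : j = k
  · subst h; simp [J]
  · simp [J, h, updateRow_ne]

theorem swap_upd (M : Matrix (Fin n) (Fin n) A) {L l : Fin n} (h : l ≠ L) (u v : Fin n → A) :
    ((M.updateRow L u).updateRow l v).det = - ((M.updateRow L v).updateRow l u).det := by
  have := (detRowAlternating (n := Fin n) (R := A)).map_swap
    ((M.updateRow L v).updateRow l u) h
  change detRowAlternating _ = - detRowAlternating _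
  rw [← this]
  congr 1
  ext i j
  change _ = ((M.updateRow L v).updateRow l u) (Equiv.swap l L i) j
  by_cases h1 : i = l
  · subst h1; simp [h.symm, updateRow_ne]
  · by_cases h2 : i = L
    · subst h2; simp [h.symm, updateRow_ne]
    · simp [h1, h2, updateRow_ne, Equiv.swap_apply_of_ne_of_ne]

theorem divfree (D : Fin n → Derivation ℝ A A)
    (hcomm : ∀ i j : Fin n, ∀ a : A, D i (D j a) = D j (D i a)) (f : Fin n → A) (L : Fin n) :
    ∑ j, D j ((J D f).adjugate j L) = 0 := by
  simp_rw [adjugate_apply, der_det]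
  rw [Finset.sum_comm]
  refine Finset.sum_eq_zero fun l _ => ?_
  by_cases h : l = L
  · subst h
    refine Finset.sum_eq_zero fun j _ => ?_
    apply det_eq_zero_of_row_eq_zero l
    intro i
    by_cases hij : i = j
    · subst hij; simp
    · simp [hij]
  · have key : ∀ j, (((J D f).updateRow L (Pi.single j 1)).updateRow l
        (fun i => D j (((J D f).updateRow L (Pi.single j 1)) l i))).det
        = ∑ m, D j (D m (f l)) *
          (((J D f).updateRow L (Pi.single j 1)).updateRow l (Pi.single m 1)).det := by
      intro j
      rw [det_upd]
      refine Finset.sum_congr rfl fun m _ => ?_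
      rw [adjugate_apply, updateRow_ne h]
      rfl
    simp_rw [key]
    set S := ∑ j, ∑ m, D j (D m (f l)) *
      (((J D f).updateRow L (Pi.single j 1)).updateRow l (Pi.single m 1)).det with hS
    have h2 : S = -S := by
      conv_lhs => rw [hS, Finset.sum_comm]
      rw [hS, ← Finset.sum_neg_distrib]
      refine Finset.sum_congr rfl fun j _ => ?_
      rw [← Finset.sum_neg_distrib]
      refine Finset.sum_congr rfl fun m _ => ?_
      rw [swap_upd _ h, hcomm, mul_neg]
    have h3 : (2 : ℝ) • S = 0 := by
      rw [two_smul]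
      nth_rewrite 1 [h2]
      simp
    have h4 := congrArg (fun x => (2 : ℝ)⁻¹ • x) h3
    simpa [smul_smul] using h4

theorem coe_sum_apply (D : Fin n → Derivation ℝ A A) (s : Finset (Fin n)) (a : A) :
    (∑ j ∈ s, D j) a = ∑ j ∈ s, D j a := by
  induction s using Finset.induction_on with
  | empty => simp
  | insert i s hi ih => rw [Finset.sum_insert hi, Finset.sum_insert hi, Derivation.add_apply, ih]

theorem fund (D : Fin n → Derivation ℝ A A)
    (hcomm : ∀ i j : Fin n, ∀ a : A, D i (D j a) = D j (D i a)) (f g : Fin n → A) (L : Fin n) :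
    (J D (Function.update f L (J D g).det)).det =
      ∑ k, (J D (Function.update g k (J D (Function.update f L (g k))).det)).det := by
  set c : Fin n → A := fun j => (J D f).adjugate j L with hc
  set X : Derivation ℝ A A := ∑ j, c j • D j with hX
  have hXa : ∀ a, (J D (Function.update f L a)).det = X a := by
    intro a
    rw [J_update, det_upd, hX, coe_sum_apply]
    refine Finset.sum_congr rfl fun j _ => ?_
    simp [hc, mul_comm]
  simp_rw [hXa, J_update]
  rw [der_det]
  set N : Matrix (Fin n) (Fin n) A := fun j i => D i (c j) with hN
  have hrow : ∀ k, (fun i => D i (X (g k))) =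
      (fun i => X (J D g k i)) + ((J D g) * N) k := by
    intro k
    ext i
    rw [Pi.add_apply, hX, mul_apply]
    simp only [coe_sum_apply, Derivation.smul_apply, map_sum,
      Derivation.leibniz, smul_eq_mul, Finset.sum_add_distrib, J, hN]
    congr 1
    refine Finset.sum_congr rfl fun j _ => ?_
    rw [hcomm]
  simp_rw [hrow, det_updateRow_add, Finset.sum_add_distrib]
  rw [trace_upd]
  have : N.trace = 0 := divfree D hcomm f L
  rw [this]
  simp

end NambuAux

/-- if `D₁,…,Dₙ` (`n = q+2 ≥ 2`) are pairwise commuting `ℝ`-linear derivations of a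
commutative `ℝ`-algebra `A`, then `{f₁,…,fₙ} := det (Dᵢ fⱼ)` is an alternating `ℝ`-multilinear
bracket satisfying the Leibniz rule and the Fundamental identity, i.e. a Nambu-Poisson bracket
of order `n` on `A`. -/
theorem det_of_commuting_derivations_is_nambu_poisson
    {A : Type*} [CommRing A] [Algebra ℝ A] {q : ℕ}
    (D : Fin (q + 2) → Derivation ℝ A A)
    (hcomm : ∀ i j : Fin (q + 2), ∀ a : A, D i (D j a) = D j (D i a)) :
    ∃ B : AlternatingMap ℝ A A (Fin (q + 2)),
      (∀ f : Fin (q + 2) → A, B f = (Matrix.of fun i j => D i (f j)).det) ∧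
      LeibnizRule ⇑B ∧ FundamentalIdentity ⇑B := by
  let B : AlternatingMap ℝ A A (Fin (q + 2)) :=
    { toFun := fun f => (NambuAux.J D f).det
      map_update_add' := by
        intro inst m i x y
        have e : (fun j => D j (x + y)) = (fun j => D j x) + (fun j => D j y) := by
          ext j; simp
        obtain rfl : inst = instDecidableEqFin _ := Subsingleton.elim _ _
        simp only [NambuAux.J_update]
        rw [e, Matrix.det_updateRow_add]
      map_update_smul' := by
        intro inst m i c x
        obtain rfl : inst = instDecidableEqFin _ := Subsingleton.elim _ _
        simp only [NambuAux.J_update, NambuAux.det_upd, Finset.smul_sum]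
        refine Finset.sum_congr rfl fun j _ => ?_
        simp
      map_eq_zero_of_eq' := by
        intro v i j h hij
        refine Matrix.det_zero_of_row_eq hij ?_
        ext k
        simp [NambuAux.J, h] }
  have hB : ∀ f, B f = (NambuAux.J D f).det := fun _ => rfl
  refine ⟨B, fun f => ?_, ?_, ?_⟩
  · rw [hB, ← Matrix.det_transpose]
    rfl
  · intro v i f g
    simp only [hB, NambuAux.J_update, NambuAux.det_upd, Finset.mul_sum, Finset.sum_mul]
    rw [← Finset.sum_add_distrib]
    refine Finset.sum_congr rfl fun j _ => ?_
    simp only [Derivation.leibniz, smul_eq_mul]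
    ring
  · intro f g
    obtain ⟨F, hs⟩ : ∃ F : Fin (q + 1 + 1) → A, ∀ a : A, (Fin.snoc f a : Fin (q + 1 + 1) → A) =
        Function.update F (Fin.last _) a :=
      ⟨Fin.snoc f (0 : A), fun a => (Fin.update_snoc_last ..).symm⟩
    simp only [hs, hB]
    exact NambuAux.fund D hcomm _ g _
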